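/- arXiv:1204.1282 — 3 statements merged into one kernel-verified Lean document; each statement's English description precedes it below -/
import Mathlib

section
/- Let Q ≥ 3 be an integer, φ(t) = −(1/Q) · Σ_{l=0}^{∞} Q^{−l} e^{−2πi Q^l t}, and U₁(t) = φ(2Qt). Define U₂(t) = (Q(Q−1)/2) · Σ_{l₁,l₂=1}^{∞} Q^{−(l₁+l₂)} φ(2(Q^{l₁}+Q^{l₂})t) + Q · Σ_{l=1}^{∞} Q^{−l} φ(2(Q^l+Q)t). Then these double and single series converge absolutely for every real t, and U₂ satisfies the functional equation U₂(Qt) − Q·U₂(t) = (Q(Q−1)/2)·U₁(t)² − e^{−2πi(2Q)t}·Q·U₁(t) for all t ∈ ℝ. -/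
/-- The function `φ(t) = -(1/Q) ∑_{l=0}^∞ Q^{-l} e^{-2πi Q^l t}`. -/
noncomputable def phi (Q : ℕ) (t : ℝ) : ℂ :=
  -(1 / (Q : ℂ)) * ∑' l : ℕ, ((Q : ℂ) ^ l)⁻¹ *
    Complex.exp (-2 * Real.pi * Complex.I * ((Q : ℝ) ^ l * t))

/-- `U₁(t) = φ(2Qt)`. -/
noncomputable def U₁ (Q : ℕ) (t : ℝ) : ℂ := phi Q (2 * (Q : ℝ) * t)

/-- `U₂(t) = (Q(Q-1)/2) ∑_{l₁,l₂=1}^∞ Q^{-(l₁+l₂)} φ(2(Q^{l₁}+Q^{l₂})t)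
    + Q ∑_{l=1}^∞ Q^{-l} φ(2(Q^l+Q)t)`. -/
noncomputable def U₂ (Q : ℕ) (t : ℝ) : ℂ :=
  ((Q : ℂ) * ((Q : ℂ) - 1) / 2) * ∑' l : ℕ × ℕ, ((Q : ℂ) ^ ((l.1 + 1) + (l.2 + 1)))⁻¹ *
      phi Q (2 * ((Q : ℝ) ^ (l.1 + 1) + (Q : ℝ) ^ (l.2 + 1)) * t)
    + (Q : ℂ) * ∑' l : ℕ, ((Q : ℂ) ^ (l + 1))⁻¹ *
      phi Q (2 * ((Q : ℝ) ^ (l + 1) + (Q : ℝ)) * t)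

/-- The character `e(t) = e^{-2πit}`. -/
noncomputable def negChar (t : ℝ) : ℂ := Complex.exp (-2 * Real.pi * Complex.I * (t : ℂ))

lemma norm_negChar (t : ℝ) : ‖negChar t‖ = 1 := by
  have : (-2 * Real.pi * Complex.I * (t : ℂ)) = ((-2 * Real.pi * t : ℝ) : ℂ) * Complex.I := by
    push_cast; ring
  rw [negChar, this, Complex.norm_exp_ofReal_mul_I]

lemma negChar_add (s t : ℝ) : negChar (s + t) = negChar s * negChar t := by
  simp only [negChar, ← Complex.exp_add]
  push_cast
  ring_nf

lemma phi_eq (Q : ℕ) (t : ℝ) :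
    phi Q t = -(1 / (Q : ℂ)) * ∑' l : ℕ, ((Q : ℂ) ^ l)⁻¹ * negChar ((Q : ℝ) ^ l * t) := by
  simp [phi, negChar]

lemma summable_inv_pow {Q : ℕ} (hQ : 1 < Q) : Summable fun l : ℕ => ((Q : ℝ) ^ l)⁻¹ := by
  simpa only [inv_pow] using summable_geometric_of_lt_one (r := (Q : ℝ)⁻¹) (by positivity)
    (inv_lt_one_of_one_lt₀ (by exact_mod_cast hQ))

/-- A series with geometric weights and bounded coefficients converges absolutely. -/
lemma summable_norm_inv_pow_mul {Q : ℕ} (hQ : 1 < Q) {a : ℕ → ℂ} {C : ℝ} (ha : ∀ l, ‖a l‖ ≤ C) :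
    Summable fun l : ℕ => ‖((Q : ℂ) ^ l)⁻¹ * a l‖ := by
  refine Summable.of_nonneg_of_le (fun _ => norm_nonneg _) (fun l => ?_)
    ((summable_inv_pow hQ).mul_right C)
  rw [norm_mul, norm_inv, norm_pow, Complex.norm_natCast]
  gcongr
  exact ha l

lemma summable_norm_inv_pow_succ_mul {Q : ℕ} (hQ : 1 < Q) {a : ℕ → ℂ} {C : ℝ}
    (ha : ∀ l, ‖a l‖ ≤ C) : Summable fun l : ℕ => ‖((Q : ℂ) ^ (l + 1))⁻¹ * a l‖ := by
  refine ((summable_norm_inv_pow_mul hQ ha).mul_left ‖(Q : ℂ)⁻¹‖).congr fun l => ?_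
  rw [← norm_mul, pow_succ, mul_inv]
  ring_nf

lemma summable_norm_inv_pow_succ_mul_prod {Q : ℕ} (hQ : 1 < Q) {a : ℕ × ℕ → ℂ} {C : ℝ}
    (ha : ∀ l, ‖a l‖ ≤ C) :
    Summable fun l : ℕ × ℕ => ‖((Q : ℂ) ^ ((l.1 + 1) + (l.2 + 1)))⁻¹ * a l‖ := by
  have hs : Summable fun l : ℕ => ((Q : ℝ) ^ (l + 1))⁻¹ :=
    (summable_nat_add_iff 1).2 (summable_inv_pow hQ)
  refine Summable.of_nonneg_of_le (fun _ => norm_nonneg _) (fun l => ?_)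
    ((hs.mul_of_nonneg hs (fun _ => by positivity) fun _ => by positivity).mul_right C)
  rw [norm_mul, norm_inv, norm_pow, Complex.norm_natCast, pow_add, mul_inv]
  gcongr
  exact ha l

lemma summable_norm_phi_term {Q : ℕ} (hQ : 1 < Q) (t : ℝ) :
    Summable fun l : ℕ => ‖((Q : ℂ) ^ l)⁻¹ * negChar ((Q : ℝ) ^ l * t)‖ :=
  summable_norm_inv_pow_mul hQ fun _ => (norm_negChar _).le

lemma norm_phi_le {Q : ℕ} (hQ : 1 < Q) (t : ℝ) :
    ‖phi Q t‖ ≤ ‖-(1 / (Q : ℂ))‖ * ∑' l : ℕ, ((Q : ℝ) ^ l)⁻¹ := by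
  rw [phi_eq, norm_mul]
  gcongr
  refine (norm_tsum_le_tsum_norm (summable_norm_phi_term hQ t)).trans_eq (tsum_congr fun l => ?_)
  rw [norm_mul, norm_negChar, norm_inv, norm_pow, Complex.norm_natCast, mul_one]

/-- `φ` written with the sum starting at `l = 1`, evaluated at `Qt`. -/
lemma phi_mul_eq_neg_tsum {Q : ℕ} (t : ℝ) :
    phi Q (Q * t) = -∑' l : ℕ, ((Q : ℂ) ^ (l + 1))⁻¹ * negChar ((Q : ℝ) ^ (l + 1) * t) := by
  rw [phi_eq, ← tsum_mul_left, ← tsum_neg]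
  refine tsum_congr fun l => ?_
  rw [← mul_assoc ((Q : ℝ) ^ l), ← pow_succ, pow_succ (Q : ℂ), mul_inv]
  ring

lemma phi_functional_equation {Q : ℕ} (hQ : 1 < Q) (t : ℝ) :
    phi Q (Q * t) = Q * phi Q t + negChar t := by
  have hQ0 : (Q : ℂ) ≠ 0 := by exact_mod_cast (by omega : Q ≠ 0)
  rw [phi_mul_eq_neg_tsum, phi_eq, (summable_norm_phi_term hQ t).of_norm.tsum_eq_zero_add]
  simp only [pow_zero, inv_one, one_mul]
  generalize ∑' l : ℕ, ((Q : ℂ) ^ (l + 1))⁻¹ * negChar ((Q : ℝ) ^ (l + 1) * t) = S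
  field_simp
  ring

lemma U₁_eq_neg_tsum (Q : ℕ) (t : ℝ) :
    U₁ Q t = -∑' l : ℕ, ((Q : ℂ) ^ (l + 1))⁻¹ * negChar ((Q : ℝ) ^ (l + 1) * (2 * t)) := by
  rw [← phi_mul_eq_neg_tsum, U₁]
  ring_nf

/-- Applying `f ↦ f(Q·) - Q f` termwise to a series `∑ cᵢ φ(xᵢ t)`. -/
lemma tsum_mul_phi_functional_equation {ι : Type*} {Q : ℕ} (hQ : 1 < Q) (c : ι → ℂ) (x : ι → ℝ)
    (hc : ∀ t : ℝ, Summable fun i => ‖c i * phi Q (x i * t)‖) (t : ℝ) :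
    ∑' i, c i * phi Q (x i * (Q * t)) - Q * ∑' i, c i * phi Q (x i * t) =
      ∑' i, c i * negChar (x i * t) := by
  rw [← tsum_mul_left, ← (hc _).of_norm.tsum_sub ((hc t).of_norm.mul_left _)]
  refine tsum_congr fun i => ?_
  rw [mul_left_comm (x i), phi_functional_equation hQ]
  ring

theorem U₂_summable_and_functional_equation (Q : ℕ) (hQ : 3 ≤ Q) :
    (∀ t : ℝ, Summable fun l : ℕ × ℕ => ‖((Q : ℂ) ^ ((l.1 + 1) + (l.2 + 1)))⁻¹ *
        phi Q (2 * ((Q : ℝ) ^ (l.1 + 1) + (Q : ℝ) ^ (l.2 + 1)) * t)‖) ∧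
    (∀ t : ℝ, Summable fun l : ℕ => ‖((Q : ℂ) ^ (l + 1))⁻¹ *
        phi Q (2 * ((Q : ℝ) ^ (l + 1) + (Q : ℝ)) * t)‖) ∧
    (∀ t : ℝ, U₂ Q ((Q : ℝ) * t) - (Q : ℂ) * U₂ Q t =
        ((Q : ℂ) * ((Q : ℂ) - 1) / 2) * (U₁ Q t) ^ 2 -
          Complex.exp (-2 * Real.pi * Complex.I * ((2 * (Q : ℝ) * t : ℝ) : ℂ)) *
            (Q : ℂ) * U₁ Q t) := by
  have hQ1 : 1 < Q := by omega
  have h₂ : ∀ t : ℝ, Summable fun l : ℕ × ℕ => ‖((Q : ℂ) ^ ((l.1 + 1) + (l.2 + 1)))⁻¹ *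
      phi Q (2 * ((Q : ℝ) ^ (l.1 + 1) + (Q : ℝ) ^ (l.2 + 1)) * t)‖ := fun t =>
    summable_norm_inv_pow_succ_mul_prod hQ1 fun _ => norm_phi_le hQ1 _
  have h₁ : ∀ t : ℝ, Summable fun l : ℕ => ‖((Q : ℂ) ^ (l + 1))⁻¹ *
      phi Q (2 * ((Q : ℝ) ^ (l + 1) + (Q : ℝ)) * t)‖ := fun t =>
    summable_norm_inv_pow_succ_mul hQ1 fun _ => norm_phi_le hQ1 _
  refine ⟨h₂, h₁, fun t => ?_⟩
  have e₂ := tsum_mul_phi_functional_equation hQ1 _ _ h₂ t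
  have e₁ := tsum_mul_phi_functional_equation hQ1 _ _ h₁ t
  have hS := summable_norm_inv_pow_succ_mul (a := fun l => negChar ((Q : ℝ) ^ (l + 1) * (2 * t)))
    hQ1 fun _ => (norm_negChar _).le
  have double : ∑' l : ℕ × ℕ, ((Q : ℂ) ^ ((l.1 + 1) + (l.2 + 1)))⁻¹ *
      negChar (2 * ((Q : ℝ) ^ (l.1 + 1) + (Q : ℝ) ^ (l.2 + 1)) * t) = U₁ Q t ^ 2 := by
    rw [U₁_eq_neg_tsum, neg_sq, sq, tsum_mul_tsum_of_summable_norm hS hS]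
    refine tsum_congr fun l => ?_
    rw [show 2 * ((Q : ℝ) ^ (l.1 + 1) + (Q : ℝ) ^ (l.2 + 1)) * t =
      (Q : ℝ) ^ (l.1 + 1) * (2 * t) + (Q : ℝ) ^ (l.2 + 1) * (2 * t) by ring,
      negChar_add, pow_add, mul_inv]
    ring
  have single : ∑' l : ℕ, ((Q : ℂ) ^ (l + 1))⁻¹ *
      negChar (2 * ((Q : ℝ) ^ (l + 1) + (Q : ℝ)) * t) = -(negChar (2 * Q * t) * U₁ Q t) := by
    rw [U₁_eq_neg_tsum, mul_neg, neg_neg, ← tsum_mul_left]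
    refine tsum_congr fun l => ?_
    rw [show 2 * ((Q : ℝ) ^ (l + 1) + (Q : ℝ)) * t =
      (Q : ℝ) ^ (l + 1) * (2 * t) + 2 * Q * t by ring, negChar_add]
    ring
  rw [double] at e₂
  rw [single] at e₁
  rw [← negChar]
  simp only [U₂]
  linear_combination ((Q : ℂ) * ((Q : ℂ) - 1) / 2) * e₂ + (Q : ℂ) * e₁
end

section
/- Let Q ≥ 3 be an integer, ω = e^{2πi/(Q−1)} and ε = e^{πi/(Q−1)}. For p ∈ ℂ let f_p(z) = z^Q + p/z^Q. Then for every p ∈ ℂ and every z ∈ ℂ with z ≠ 0 and f_p(z) ≠ 0, the second iterate satisfies f_{ωp}(f_{ωp}(εz)) = (−1)^{Q+1}·ε·f_p(f_p(z)). In particular, when Q is odd, f_{ωp}∘f_{ωp} restricted to the rotated plane is conjugate to f_p∘f_p via multiplication by ε. -/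
/-- The McMullen map `f_p(z) = z^Q + p/z^Q`. -/
noncomputable def mcmullen (Q : ℕ) (p : ℂ) (z : ℂ) : ℂ := z ^ Q + p / z ^ Q

/-- If `e ^ Q = c * e` with `c ^ 2 = 1`, then `z ↦ e * z` intertwines `f_p` and `f_{e² p}` up to the
factor `c`. -/
theorem mcmullen_sq_mul_mul {Q : ℕ} {e c : ℂ} (he : e ≠ 0) (hc : c ^ 2 = 1)
    (heQ : e ^ Q = c * e) (p z : ℂ) :
    mcmullen Q (e ^ 2 * p) (e * z) = c * e * mcmullen Q p z := by
  have hc_inv : c⁻¹ = c := inv_eq_of_mul_eq_one_left (by rw [← sq, hc])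
  have h : e ^ 2 * p / (c * e * z ^ Q) = c * e * (p / z ^ Q) := by
    rw [div_eq_mul_inv, mul_inv, mul_inv, hc_inv, div_eq_mul_inv]
    field_simp
  rw [mcmullen, mcmullen, mul_pow, heQ, h]
  ring

theorem exp_pi_mul_I_div_pow {Q : ℕ} (hQ : 2 ≤ Q) :
    Complex.exp (Real.pi * Complex.I / ((Q : ℂ) - 1)) ^ Q =
      -1 * Complex.exp (Real.pi * Complex.I / ((Q : ℂ) - 1)) := by
  have hQ1 : (Q : ℂ) - 1 ≠ 0 := sub_ne_zero.mpr (by exact_mod_cast (by omega : Q ≠ 1))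
  rw [← Complex.exp_nat_mul, ← Complex.exp_pi_mul_I, ← Complex.exp_add]
  congr 1
  field_simp
  ring

theorem mcmullen_second_iterate_symmetry (Q : ℕ) (hQ : 3 ≤ Q) (p : ℂ) (z : ℂ)
    (hz : z ≠ 0) (hfz : mcmullen Q p z ≠ 0) :
    (mcmullen Q (Complex.exp (2 * Real.pi * Complex.I / ((Q : ℂ) - 1)) * p)
        (mcmullen Q (Complex.exp (2 * Real.pi * Complex.I / ((Q : ℂ) - 1)) * p)
          (Complex.exp (Real.pi * Complex.I / ((Q : ℂ) - 1)) * z)) =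
      (-1 : ℂ) ^ (Q + 1) * Complex.exp (Real.pi * Complex.I / ((Q : ℂ) - 1)) *
        mcmullen Q p (mcmullen Q p z)) ∧
    (Odd Q →
      mcmullen Q (Complex.exp (2 * Real.pi * Complex.I / ((Q : ℂ) - 1)) * p)
          (mcmullen Q (Complex.exp (2 * Real.pi * Complex.I / ((Q : ℂ) - 1)) * p)
            (Complex.exp (Real.pi * Complex.I / ((Q : ℂ) - 1)) * z)) =
        Complex.exp (Real.pi * Complex.I / ((Q : ℂ) - 1)) *
          mcmullen Q p (mcmullen Q p z)) := by
  have hω : Complex.exp (2 * Real.pi * Complex.I / ((Q : ℂ) - 1)) =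
      Complex.exp (Real.pi * Complex.I / ((Q : ℂ) - 1)) ^ 2 := by
    rw [← Complex.exp_nat_mul]
    congr 1
    push_cast
    ring
  have hε := exp_pi_mul_I_div_pow (show 2 ≤ Q by omega)
  have hε0 := Complex.exp_ne_zero (Real.pi * Complex.I / ((Q : ℂ) - 1))
  rw [hω]
  generalize Complex.exp (Real.pi * Complex.I / ((Q : ℂ) - 1)) = ε at hε hε0 ⊢
  have key : mcmullen Q (ε ^ 2 * p) (mcmullen Q (ε ^ 2 * p) (ε * z)) =
      (-1 : ℂ) ^ (Q + 1) * ε * mcmullen Q p (mcmullen Q p z) := by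
    have hneg : (-ε) ^ Q = (-1) ^ Q * -ε := by rw [neg_pow, hε, neg_one_mul]
    have hsq : ((-1 : ℂ) ^ Q) ^ 2 = 1 := by rw [← pow_mul, mul_comm, pow_mul]; simp
    rw [mcmullen_sq_mul_mul hε0 (by norm_num) hε, neg_one_mul, ← neg_sq ε,
      mcmullen_sq_mul_mul (neg_ne_zero.mpr hε0) hsq hneg]
    ring
  refine ⟨key, fun hodd => ?_⟩
  rw [key, hodd.add_one.neg_one_pow, one_mul]
end

section
/- Let Q ≥ 3 be an integer. There exists ε > 0 such that for every real p with 0 < p < ε, the map x ↦ x^Q + p/x^Q has exactly two fixed points in the open interval (0, ∞); that is, the equation x^Q + p/x^Q = x has exactly two solutions x > 0. -/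
theorem pow_add_div_pow_eq_self_iff {Q : ℕ} {p x : ℝ} (hx : 0 < x) :
    x ^ Q + p / x ^ Q = x ↔ (x ^ Q) ^ 2 + p - x * x ^ Q = 0 := by
  have h : 0 < x ^ Q := by positivity
  rw [← sub_eq_zero (b := x), ← mul_left_inj' h.ne', zero_mul]
  field_simp

/-- On the positive reals, the fixed points are the points where the strictly convex function
`x ↦ x ^ (Q - 1) + p * x ^ (-(Q + 1))` takes the value `1`. -/
theorem pow_add_mul_zpow_eq_one_of_fixed {n : ℕ} {p x : ℝ} (hx : 0 < x)
    (h : x ^ (n + 1) + p / x ^ (n + 1) = x) :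
    x ^ n + p * x ^ (-((n + 2 : ℕ) : ℤ)) = 1 := by
  rw [zpow_neg, zpow_natCast]
  field_simp at h ⊢
  ring_nf at h ⊢
  linear_combination h

theorem strictConvexOn_pow_add_mul_zpow {n : ℕ} (hn : 2 ≤ n) {p : ℝ} (hp : 0 ≤ p) (m : ℤ) :
    StrictConvexOn ℝ (Set.Ioi 0) fun x : ℝ ↦ x ^ n + p * x ^ m :=
  ((strictConvexOn_pow hn).subset Set.Ioi_subset_Ici_self (convex_Ioi 0)).add_convexOn
    ((convexOn_zpow m).smul hp)

/-- A strictly convex function takes no value at three distinct points. -/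
theorem StrictConvexOn.not_eq_of_lt_of_lt {s : Set ℝ} {f : ℝ → ℝ} (hf : StrictConvexOn ℝ s f)
    {a b c y : ℝ} (ha : a ∈ s) (hc : c ∈ s) (hab : a < b) (hbc : b < c)
    (hfa : f a = y) (hfb : f b = y) (hfc : f c = y) : False := by
  have h := hf.lt_on_openSegment ha hc (hab.trans hbc).ne
    (by rw [openSegment_eq_Ioo (hab.trans hbc)]; exact ⟨hab, hbc⟩)
  simp [hfa, hfb, hfc] at h

theorem two_positive_fixed_points (Q : ℕ) (hQ : 3 ≤ Q) :
    ∃ ε > 0, ∀ p : ℝ, 0 < p → p < ε →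
      {x : ℝ | 0 < x ∧ x ^ Q + p / x ^ Q = x}.ncard = 2 := by
  obtain ⟨n, rfl⟩ := Nat.exists_eq_add_of_le' hQ
  refine ⟨(1 / 2) ^ (n + 5), by positivity, fun p hp hpε ↦ ?_⟩
  let f : ℝ → ℝ := fun x ↦ (x ^ (n + 3)) ^ 2 + p - x * x ^ (n + 3)
  have hf : Continuous f := by fun_prop
  have h0 : 0 < f 0 := by simpa [f] using hp
  have h1 : 0 < f 1 := by simpa [f] using hp
  have hhalf : f (1 / 2) < 0 := by
    have hy : (0 : ℝ) < (1 / 2) ^ n := by positivity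
    have hy1 : ((1 : ℝ) / 2) ^ n ≤ 1 := pow_le_one₀ (by norm_num) (by norm_num)
    simp only [f, pow_add] at hpε ⊢
    nlinarith
  obtain ⟨a, ⟨ha0, ha⟩, hfa⟩ := intermediate_value_Ioo' (by norm_num) hf.continuousOn ⟨hhalf, h0⟩
  obtain ⟨b, ⟨hb, hb1⟩, hfb⟩ := intermediate_value_Ioo (by norm_num) hf.continuousOn ⟨hhalf, h1⟩
  have hab : a < b := ha.trans hb
  have hb0 : 0 < b := ha0.trans hab
  have hfixa := (pow_add_div_pow_eq_self_iff ha0).2 hfa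
  have hfixb := (pow_add_div_pow_eq_self_iff hb0).2 hfb
  have hconv := strictConvexOn_pow_add_mul_zpow (n := n + 2) (by omega) hp.le
    (-((n + 2 + 2 : ℕ) : ℤ))
  have hga := pow_add_mul_zpow_eq_one_of_fixed ha0 hfixa
  have hgb := pow_add_mul_zpow_eq_one_of_fixed hb0 hfixb
  rw [Set.ncard_eq_two]
  refine ⟨a, b, hab.ne, Set.Subset.antisymm ?_ ?_⟩
  · rintro x ⟨hx0, hx⟩
    have hgx := pow_add_mul_zpow_eq_one_of_fixed hx0 hx
    by_contra hne
    simp only [Set.mem_insert_iff, Set.mem_singleton_iff, not_or] at hne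
    rcases lt_or_gt_of_ne hne.1 with hxa | hax
    · exact hconv.not_eq_of_lt_of_lt hx0 hb0 hxa hab hgx hga hgb
    rcases lt_or_gt_of_ne hne.2 with hxb | hbx
    · exact hconv.not_eq_of_lt_of_lt ha0 hb0 hax hxb hga hgx hgb
    · exact hconv.not_eq_of_lt_of_lt ha0 hx0 hab hbx hga hgb hgx
  · rintro x (rfl | rfl)
    · exact ⟨ha0, hfixa⟩
    · exact ⟨hb0, hfixb⟩
end
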